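/- (Lemma 5, two-parameter case.) Fix ρ₁, ρ₂ with 0 < ρ₁ ≤ ρ₂ ≤ 1. For all z, z₁, z₂ ∈ [0, 1] and λ ∈ [0, 1] satisfying g(ρ₁, z) = λ·g(ρ₁, z₁) + (1−λ)·g(ρ₁, z₂), one has D(ρ₂, z) ≥ λ·D(ρ₂, z₁) + (1−λ)·D(ρ₂, z₂); that is, the function t ↦ D(ρ₂, g(ρ₁,·)⁻¹(t)) is concave on the image of [0, 1] under g(ρ₁, ·). -/

import Mathlib

/-- Gallager's `g` function: `g(ρ, z) = (½(1+z)^{1/(1+ρ)} + ½(1−z)^{1/(1+ρ)})^{1+ρ}`,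
with real powers. -/
noncomputable def g (ρ z : ℝ) : ℝ :=
  ((1/2) * (1+z) ^ (1/(1+ρ)) + (1/2) * (1-z) ^ (1/(1+ρ))) ^ (1+ρ)

/-- `D(ρ, z)`: the derivative of `r ↦ g(r, z)` at `r = ρ`. -/
noncomputable def Dg (ρ z : ℝ) : ℝ := deriv (fun r => g r z) ρ

open Real Set Filter Topology

theorem concave_of_derivative_ratio_mono {f k f' k' r : ℝ → ℝ}
    (hfc : ContinuousOn f (Icc 0 1)) (hkc : ContinuousOn k (Icc 0 1))
    (hf : ∀ x ∈ Ioo (0 : ℝ) 1, HasDerivAt f (f' x) x)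
    (hk : ∀ x ∈ Ioo (0 : ℝ) 1, HasDerivAt k (k' x) x)
    (hneg : ∀ x ∈ Ioo (0 : ℝ) 1, k' x < 0)
    (hfr : ∀ x ∈ Ioo (0 : ℝ) 1, f' x = r x * k' x)
    (hr : MonotoneOn r (Ioo 0 1))
    {z z₁ z₂ l : ℝ} (hz : z ∈ Icc (0 : ℝ) 1) (hz₁ : z₁ ∈ Icc (0 : ℝ) 1)
    (hz₂ : z₂ ∈ Icc (0 : ℝ) 1) (hl : l ∈ Icc (0 : ℝ) 1)
    (hcomb : k z = l * k z₁ + (1 - l) * k z₂) :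
    l * f z₁ + (1 - l) * f z₂ ≤ f z := by
  have hanti : StrictAntiOn k (Icc 0 1) := by
    refine strictAntiOn_of_deriv_neg (convex_Icc 0 1) hkc fun x hx => ?_
    rw [interior_Icc] at hx
    rw [(hk x hx).deriv]
    exact hneg x hx
  wlog h12 : z₁ ≤ z₂ generalizing z₁ z₂ l with H
  · have := H hz₂ hz₁ (l := 1 - l) ⟨by linarith [hl.2], by linarith [hl.1]⟩
      (by rw [hcomb]; ring) (le_of_not_ge h12)
    linarith
  have hslope : ∀ a ∈ Icc (0 : ℝ) 1, ∀ b ∈ Icc (0 : ℝ) 1, a < b →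
      ∃ c ∈ Ioo a b, f b - f a = r c * (k b - k a) := by
    intro a ha b hb hab
    have hsub : Ioo a b ⊆ Ioo 0 1 := Ioo_subset_Ioo ha.1 hb.2
    have hsub' : Icc a b ⊆ Icc 0 1 := Icc_subset_Icc ha.1 hb.2
    obtain ⟨c, hc, h⟩ := exists_ratio_hasDerivAt_eq_ratio_slope f f' hab (hfc.mono hsub')
      (fun x hx => hf x (hsub hx)) k k' (hkc.mono hsub') (fun x hx => hk x (hsub hx))
    refine ⟨c, hc, ?_⟩
    have hn := hneg c (hsub hc)
    rw [hfr c (hsub hc)] at h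
    apply mul_right_cancel₀ hn.ne
    linarith
  have hk12 : k z₂ ≤ k z₁ := hanti.antitoneOn hz₁ hz₂ h12
  have h1z : z₁ ≤ z := by
    rw [← hanti.le_iff_ge hz hz₁, hcomb]
    nlinarith [hl.2]
  have hz2 : z ≤ z₂ := by
    rw [← hanti.le_iff_ge hz₂ hz, hcomb]
    nlinarith [hl.1]
  rcases h12.eq_or_lt with rfl | hlt
  · have : z = z₁ := le_antisymm hz2 h1z
    subst this
    linarith
  have hklt := hanti hz₁ hz₂ hlt
  rcases h1z.eq_or_lt with rfl | h1z
  · have : (1 - l) * (k z₁ - k z₂) = 0 := by linarith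
    rcases mul_eq_zero.1 this with h | h
    · have : l = 1 := by linarith
      subst this
      linarith
    · linarith
  rcases hz2.eq_or_lt with rfl | hz2
  · have : l * (k z₁ - k z) = 0 := by linarith
    rcases mul_eq_zero.1 this with h | h
    · subst h
      linarith
    · linarith
  obtain ⟨c, hc, hc'⟩ := hslope z₁ hz₁ z hz h1z
  obtain ⟨d, hd, hd'⟩ := hslope z hz z₂ hz₂ hz2
  have hcd : r c ≤ r d := hr ⟨hz₁.1.trans_lt hc.1, hc.2.trans_le hz.2⟩
    ⟨hz.1.trans_lt hd.1, hd.2.trans_le hz₂.2⟩ (hc.2.trans hd.1).le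
  have hX : l * (k z - k z₁) = (1 - l) * (k z₂ - k z) := by linarith
  have hX0 : l * (k z - k z₁) ≤ 0 :=
    mul_nonpos_of_nonneg_of_nonpos hl.1 (by linarith [hanti hz₁ hz h1z])
  have e : f z - (l * f z₁ + (1 - l) * f z₂) =
      r c * (l * (k z - k z₁)) - r d * (l * (k z - k z₁)) := by
    calc _ = l * (f z - f z₁) - (1 - l) * (f z₂ - f z) := by ring
      _ = r c * (l * (k z - k z₁)) - r d * ((1 - l) * (k z₂ - k z)) := by rw [hc', hd']; ring
      _ = _ := by rw [hX]
  nlinarith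

theorem convexOn_sinh : ConvexOn ℝ (Ici 0) sinh := by
  refine MonotoneOn.convexOn_of_deriv (convex_Ici 0) continuous_sinh.continuousOn
    differentiable_sinh.differentiableOn ?_
  rw [Real.deriv_sinh, interior_Ici]
  exact cosh_strictMonoOn.monotoneOn.mono Ioi_subset_Ici_self

theorem mul_cosh_sub_le {p q : ℝ} (hq : 0 < q) (hqp : q ≤ p) :
    q * cosh (p - q) ≤ cosh p * sinh q := by
  have h := convexOn_sinh.le_slope_of_hasDerivAt (x := p - q) (y := p + q)
    (by simpa using hqp) (by simp; linarith) (by linarith) (hasDerivAt_sinh _)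
  rw [slope_def_field, le_div_iff₀ (by linarith), sinh_add, sinh_sub] at h
  linarith

theorem cosh_mul_sinh_div_mono {u s t : ℝ} (hu : 0 < u) (hs : 1 / 2 ≤ s) (hst : s ≤ t)
    (ht : t < 1) :
    cosh (s * u) * sinh ((1 - s) * u) / (1 - s) ≤ cosh (t * u) * sinh ((1 - t) * u) / (1 - t) := by
  have aux : ∀ x, x < 1 → cosh (x * u) * sinh ((1 - x) * u) / (1 - x)
      = u * ((sinh ((2 * x - 1) * u) - sinh u) / ((2 * x - 1) * u - u)) := by
    intro x hx
    have e1 : (2 * x - 1) * u = x * u - (1 - x) * u := by ring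
    have e2 : sinh u = sinh (x * u + (1 - x) * u) := by congr 1; ring
    have e3 : (2 * x - 1) * u - u = - (2 * (1 - x) * u) := by ring
    have : 1 - x ≠ 0 := by linarith
    rw [e3, e1, e2, sinh_sub, sinh_add]
    field_simp
    ring
  rw [aux s (by linarith), aux t ht]
  refine mul_le_mul_of_nonneg_left ?_ hu.le
  refine convexOn_sinh.secant_mono hu.le ?_ ?_ ?_ ?_ ?_
  · exact mul_nonneg (by linarith) hu.le
  · exact mul_nonneg (by linarith) hu.le
  · intro h; nlinarith
  · intro h; nlinarith
  · nlinarith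

/-- Up to a term that does not depend on `s`, the logarithm of `-∂ᵤ g(ρ, tanh u)` for
`s = 1 / (1 + ρ)`. -/
noncomputable def logSlope (s u : ℝ) : ℝ :=
  (1 / s - 1) * log (cosh (s * u)) + log (sinh ((1 - s) * u))

/-- The derivative of `logSlope` in `ρ`, where `s = 1 / (1 + ρ)`. -/
noncomputable def logSlopeRate (s u : ℝ) : ℝ :=
  log (cosh (s * u)) - s * u * (sinh (s * u) / cosh (s * u)) +
    s ^ 2 * u * (sinh (s * u) / cosh (s * u) + cosh ((1 - s) * u) / sinh ((1 - s) * u))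

theorem hasDerivAt_cosh_mul (s u : ℝ) :
    HasDerivAt (fun x => cosh (s * x)) (sinh (s * u) * s) u := by
  simpa using ((hasDerivAt_id u).const_mul s).cosh

theorem hasDerivAt_sinh_mul (s u : ℝ) :
    HasDerivAt (fun x => sinh (s * x)) (cosh (s * u) * s) u := by
  simpa using ((hasDerivAt_id u).const_mul s).sinh

theorem hasDerivAt_log_cosh_mul (s u : ℝ) :
    HasDerivAt (fun x => log (cosh (s * x))) (sinh (s * u) * s / cosh (s * u)) u :=
  (hasDerivAt_cosh_mul s u).log (cosh_pos _).ne'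

theorem hasDerivAt_logSlope {s u : ℝ} (hs : 0 < s) (hs1 : s < 1) (hu : 0 < u) :
    HasDerivAt (logSlope s)
      (cosh u * (1 / (cosh (s * u) * sinh ((1 - s) * u) / (1 - s)))) u := by
  have hq : 0 < sinh ((1 - s) * u) := sinh_pos_iff.2 (mul_pos (by linarith) hu)
  have h := ((hasDerivAt_log_cosh_mul s u).const_mul (1 / s - 1)).add
    ((hasDerivAt_sinh_mul (1 - s) u).log hq.ne')
  refine h.congr_deriv ?_
  have e : cosh u = cosh (s * u + (1 - s) * u) := by congr 1; ring
  have hc := cosh_pos (s * u)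
  have : 1 - s ≠ 0 := by linarith
  rw [e, cosh_add]
  field_simp
  ring

theorem logSlope_sub_mono {s t : ℝ} (hs : 1 / 2 ≤ s) (hst : s ≤ t) (ht : t < 1) :
    MonotoneOn (fun u => logSlope s u - logSlope t u) (Ioi 0) := by
  have hd : ∀ u ∈ Ioi (0 : ℝ), HasDerivAt (fun u => logSlope s u - logSlope t u) _ u :=
    fun u hu => (hasDerivAt_logSlope (by linarith) (by linarith) hu).sub
      (hasDerivAt_logSlope (by linarith) ht hu)
  refine monotoneOn_of_deriv_nonneg (convex_Ioi 0)
    (fun u hu => (hd u hu).continuousAt.continuousWithinAt)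
    (fun u hu => ((hd u (interior_subset hu)).differentiableAt).differentiableWithinAt) ?_
  intro u hu
  rw [interior_Ioi] at hu
  rw [(hd u hu).deriv, sub_nonneg]
  refine mul_le_mul_of_nonneg_left (one_div_le_one_div_of_le ?_
    (cosh_mul_sinh_div_mono hu hs hst ht)) (cosh_pos _).le
  exact div_pos (mul_pos (cosh_pos _) (sinh_pos_iff.2 (mul_pos (by linarith) hu))) (by linarith)

theorem logSlopeRate_nonneg {s u : ℝ} (hs : 1 / 2 ≤ s) (hs1 : s < 1) (hu : 0 < u) :
    0 ≤ logSlopeRate s u := by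
  have hq : 0 < sinh ((1 - s) * u) := sinh_pos_iff.2 (mul_pos (by linarith) hu)
  have h1 : sinh (s * u) / cosh (s * u) ≤ 1 := (div_le_one (cosh_pos _)).2 (sinh_lt_cosh _).le
  have h2 : 1 ≤ cosh ((1 - s) * u) / sinh ((1 - s) * u) := (one_le_div hq).2 (sinh_lt_cosh _).le
  have h3 : 0 ≤ log (cosh (s * u)) := log_nonneg (one_le_cosh _)
  have e : logSlopeRate s u = log (cosh (s * u)) + s * u *
      (s * (cosh ((1 - s) * u) / sinh ((1 - s) * u)) - (1 - s) * (sinh (s * u) / cosh (s * u))) := by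
    unfold logSlopeRate; ring
  rw [e]
  have : 0 ≤ s * (cosh ((1 - s) * u) / sinh ((1 - s) * u)) -
    (1 - s) * (sinh (s * u) / cosh (s * u)) := by nlinarith
  have : 0 ≤ s * u := by nlinarith
  positivity

theorem logSlopeRate_mono {s : ℝ} (hs : 1 / 2 ≤ s) (hs1 : s < 1) :
    MonotoneOn (logSlopeRate s) (Ioi 0) := by
  have hd : ∀ u ∈ Ioi (0 : ℝ), HasDerivAt (logSlopeRate s)
      (s ^ 2 * cosh u * (cosh (s * u) * sinh ((1 - s) * u) -
        (1 - s) * u * cosh (s * u - (1 - s) * u)) /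
        (sinh ((1 - s) * u) ^ 2 * cosh (s * u) ^ 2)) u := by
    intro u hu
    have hq : 0 < sinh ((1 - s) * u) := sinh_pos_iff.2 (mul_pos (by linarith) hu)
    have hc := cosh_pos (s * u)
    have ht := (hasDerivAt_sinh_mul s u).div (hasDerivAt_cosh_mul s u) hc.ne'
    have h := ((hasDerivAt_log_cosh_mul s u).sub (((hasDerivAt_id u).const_mul s).mul ht)).add
      (((hasDerivAt_id u).const_mul (s ^ 2)).mul (ht.add
        ((hasDerivAt_cosh_mul (1 - s) u).div (hasDerivAt_sinh_mul (1 - s) u) hq.ne')))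
    refine h.congr_deriv ?_
    have e : cosh u = cosh (s * u + (1 - s) * u) := by congr 1; ring
    rw [e, cosh_add, cosh_sub]
    simp only [id, Pi.div_apply, Pi.add_apply]
    generalize cosh (s * u) = C at *
    generalize sinh (s * u) = S at *
    generalize cosh ((1 - s) * u) = c at *
    generalize sinh ((1 - s) * u) = d at *
    field_simp
    ring
  refine monotoneOn_of_deriv_nonneg (convex_Ioi 0)
    (fun u hu => (hd u hu).continuousAt.continuousWithinAt)
    (fun u hu => ((hd u (interior_subset hu)).differentiableAt).differentiableWithinAt) ?_
  intro u hu
  rw [interior_Ioi] at hu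
  rw [(hd u hu).deriv]
  have h := mul_cosh_sub_le (p := s * u) (mul_pos (by linarith : 0 < 1 - s) hu)
    (mul_le_mul_of_nonneg_right (by linarith) (le_of_lt hu))
  have := cosh_pos u
  exact div_nonneg (mul_nonneg (by positivity) (sub_nonneg.2 h)) (by positivity)

theorem g_tanh {ρ : ℝ} (hρ : -1 < ρ) (u : ℝ) :
    g ρ (tanh u) = exp ((1 + ρ) * log (cosh (u / (1 + ρ))) - log (cosh u)) := by
  have hc := cosh_pos u
  have hp : 0 < 1 + ρ := by linarith
  have e1 : 1 + tanh u = exp (u - log (cosh u)) := by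
    rw [exp_sub, exp_log hc, tanh_eq_sinh_div_cosh, ← cosh_add_sinh]; field_simp
  have e2 : 1 - tanh u = exp (-u - log (cosh u)) := by
    rw [exp_sub, exp_log hc, tanh_eq_sinh_div_cosh, ← cosh_sub_sinh]; field_simp
  unfold g
  rw [e1, e2, ← exp_mul, ← exp_mul]
  have e3 : (1 / 2) * exp ((u - log (cosh u)) * (1 / (1 + ρ))) +
      (1 / 2) * exp ((-u - log (cosh u)) * (1 / (1 + ρ))) =
      exp (log (cosh (u / (1 + ρ))) - log (cosh u) / (1 + ρ)) := by
    rw [exp_sub, exp_log (cosh_pos _), cosh_eq (u / (1 + ρ))]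
    have a1 : (u - log (cosh u)) * (1 / (1 + ρ)) = u / (1 + ρ) - log (cosh u) / (1 + ρ) := by ring
    have a2 : (-u - log (cosh u)) * (1 / (1 + ρ)) = -(u / (1 + ρ)) - log (cosh u) / (1 + ρ) := by
      ring
    rw [a1, a2, exp_sub, exp_sub]
    ring
  rw [e3, ← exp_mul]
  congr 1
  field_simp

theorem Dg_tanh {ρ : ℝ} (hρ : -1 < ρ) (u : ℝ) :
    Dg ρ (tanh u) = exp ((1 + ρ) * log (cosh (u / (1 + ρ))) - log (cosh u)) *
      (log (cosh (u / (1 + ρ))) - u / (1 + ρ) * (sinh (u / (1 + ρ)) / cosh (u / (1 + ρ)))) := by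
  have hp : 1 + ρ ≠ 0 := by linarith
  have hev : (fun r => g r (tanh u)) =ᶠ[𝓝 ρ]
      fun r => exp ((1 + r) * log (cosh (u / (1 + r))) - log (cosh u)) := by
    filter_upwards [Ioi_mem_nhds hρ] with r hr using g_tanh hr u
  have h1 : HasDerivAt (fun r : ℝ => 1 + r) 1 ρ := by
    simpa using (hasDerivAt_id ρ).const_add 1
  have h2 := ((hasDerivAt_const ρ u).div h1 hp).cosh.log (cosh_pos _).ne'
  have h := ((h1.mul h2).sub_const (log (cosh u))).exp
  unfold Dg
  rw [hev.deriv_eq]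
  refine h.deriv.trans ?_
  simp only [Pi.div_apply, Pi.mul_apply]
  have := cosh_pos (u / (1 + ρ))
  congr 1
  generalize cosh (u / (1 + ρ)) = C at *
  field_simp
  ring

theorem hasDerivAt_artanh {z : ℝ} (hz : z ∈ Ioo (-1 : ℝ) 1) :
    HasDerivAt artanh (1 / (1 - z ^ 2)) z := by
  have hev : artanh =ᶠ[𝓝 z] fun x => 1 / 2 * log ((1 + x) / (1 - x)) := by
    filter_upwards [Ioo_mem_nhds hz.1 hz.2] with x hx
    exact artanh_eq_half_log (Ioo_subset_Icc_self hx)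
  have a : 0 < 1 + z := by linarith [hz.1]
  have b : 0 < 1 - z := by linarith [hz.2]
  have h := ((((hasDerivAt_id z).const_add 1).div ((hasDerivAt_id z).const_sub 1) b.ne').log
    (div_pos a b).ne').const_mul (1 / 2)
  refine (h.congr_of_eventuallyEq hev).congr_deriv ?_
  have : 1 - z ^ 2 = (1 + z) * (1 - z) := by ring
  simp only [id, Pi.div_apply, this]
  field_simp
  ring

theorem hasDerivAt_exp_log_cosh {s u : ℝ} (hs : 0 < s) (hs1 : s < 1) (hu : 0 < u) :
    HasDerivAt (fun x => exp (1 / s * log (cosh (s * x)) - log (cosh x)))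
      (-exp (logSlope s u - 2 * log (cosh u))) u := by
  have hq : 0 < sinh ((1 - s) * u) := sinh_pos_iff.2 (mul_pos (by linarith) hu)
  have h0 : HasDerivAt (fun x => log (cosh x)) (sinh u / cosh u) u :=
    (hasDerivAt_cosh u).log (cosh_pos u).ne'
  have h := (((hasDerivAt_log_cosh_mul s u).const_mul (1 / s)).sub h0).exp
  refine h.congr_deriv ?_
  have hC := cosh_pos (s * u)
  have hc := cosh_pos u
  have e : logSlope s u - 2 * log (cosh u) = (1 / s * log (cosh (s * u)) - log (cosh u)) +
      (log (sinh ((1 - s) * u)) - log (cosh (s * u)) - log (cosh u)) := by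
    unfold logSlope; ring
  have e2 : (1 - s) * u = u - s * u := by ring
  rw [e, exp_add, exp_sub (_ - _) (log (cosh u)), exp_sub (log (sinh _)), exp_log hq, exp_log hC,
    exp_log hc, e2, sinh_sub]
  simp only [Pi.sub_apply]
  field_simp
  ring

theorem hasDerivAt_exp_log_cosh_mul {s u : ℝ} (hs : 0 < s) (hs1 : s < 1) (hu : 0 < u) :
    HasDerivAt (fun x => exp (1 / s * log (cosh (s * x)) - log (cosh x)) *
        (log (cosh (s * x)) - s * x * (sinh (s * x) / cosh (s * x))))
      (logSlopeRate s u * -exp (logSlope s u - 2 * log (cosh u))) u := by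
  have hq : 0 < sinh ((1 - s) * u) := sinh_pos_iff.2 (mul_pos (by linarith) hu)
  have hC := cosh_pos (s * u)
  have hc := cosh_pos u
  have ht := (hasDerivAt_sinh_mul s u).div (hasDerivAt_cosh_mul s u) hC.ne'
  have h := (hasDerivAt_exp_log_cosh hs hs1 hu).mul
    ((hasDerivAt_log_cosh_mul s u).sub (((hasDerivAt_id u).const_mul s).mul ht))
  refine h.congr_deriv ?_
  have e : logSlope s u - 2 * log (cosh u) = (1 / s * log (cosh (s * u)) - log (cosh u)) +
      (log (sinh ((1 - s) * u)) - log (cosh (s * u)) - log (cosh u)) := by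
    unfold logSlope; ring
  have e2 : cosh u = cosh (s * u + (1 - s) * u) := by congr 1; ring
  rw [e, exp_add, exp_sub (_ - _) (log (cosh u)), exp_sub (log (sinh _)), exp_log hq, exp_log hC,
    exp_log hc]
  simp only [Pi.sub_apply, Pi.div_apply, Pi.mul_apply, id]
  unfold logSlopeRate
  generalize exp (1 / s * log (cosh (s * u)) - log (cosh u)) = E
  generalize log (cosh (s * u)) = L
  have i1 := cosh_sq (s * u)
  rw [cosh_add] at e2
  generalize cosh (s * u) = C at *
  generalize sinh (s * u) = S at *
  generalize cosh ((1 - s) * u) = c at *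
  generalize sinh ((1 - s) * u) = d at *
  generalize cosh u = W at *
  have hS : S ^ 2 = C ^ 2 - 1 := by linarith
  field_simp
  linear_combination (-E * s ^ 2 * u) * e2 + (E * s ^ 2 * u * W) * hS

theorem continuousOn_rpow_mul_log {s : ℝ} (hs : 0 < s) :
    ContinuousOn (fun x : ℝ => x ^ s * log x) (Ici 0) := by
  have h : ContinuousOn (fun x : ℝ => 1 / s * (x ^ s * log (x ^ s))) (Ici 0) := by
    have : Continuous (fun x : ℝ => 1 / s * (x ^ s * log (x ^ s))) :=
      continuous_const.mul (continuous_mul_log.comp (continuous_rpow_const hs.le))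
    exact this.continuousOn
  refine h.congr fun x hx => ?_
  rcases eq_or_lt_of_le (show 0 ≤ x from hx) with rfl | hx
  · simp [zero_rpow hs.ne']
  · simp only [log_rpow hx]
    field_simp

theorem hasDerivAt_rpow_one_div {a ρ : ℝ} (ha : 0 ≤ a) (hρ : -1 < ρ) :
    HasDerivAt (fun r => a ^ (1 / (1 + r))) (-(a ^ (1 / (1 + ρ)) * log a) / (1 + ρ) ^ 2) ρ := by
  have hp : 1 + ρ ≠ 0 := by linarith
  rcases ha.eq_or_lt with rfl | ha
  · have hev : (fun r : ℝ => (0 : ℝ) ^ (1 / (1 + r))) =ᶠ[𝓝 ρ] fun _ => 0 := by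
      filter_upwards [Ioi_mem_nhds hρ] with r hr
      exact zero_rpow (one_div_pos.2 (by linarith [mem_Ioi.1 hr])).ne'
    simpa using (hasDerivAt_const ρ (0 : ℝ)).congr_of_eventuallyEq hev
  · have h1 : HasDerivAt (fun r : ℝ => 1 + r) 1 ρ := by
      simpa using (hasDerivAt_id ρ).const_add 1
    have h := ((hasDerivAt_const ρ (1 : ℝ)).div h1 hp).const_rpow ha
    refine h.congr_deriv ?_
    simp only [Pi.div_apply]
    field_simp
    ring

theorem mean_rpow_pos {s z : ℝ} (hz : z ∈ Icc (0 : ℝ) 1) :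
    0 < (1 / 2) * (1 + z) ^ s + (1 / 2) * (1 - z) ^ s := by
  have a : 0 < (1 + z) ^ s := rpow_pos_of_pos (by linarith [hz.1]) _
  have b : 0 ≤ (1 - z) ^ s := rpow_nonneg (by linarith [hz.2]) _
  positivity

theorem continuousOn_mean_rpow {s : ℝ} (hs : 0 < s) :
    ContinuousOn (fun z : ℝ => (1 / 2) * (1 + z) ^ s + (1 / 2) * (1 - z) ^ s) (Icc 0 1) := by
  have h1 := (continuous_rpow_const hs.le).comp
    (continuous_const.add continuous_id : Continuous fun z : ℝ => 1 + z)
  have h2 := (continuous_rpow_const hs.le).comp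
    (continuous_const.sub continuous_id : Continuous fun z : ℝ => 1 - z)
  exact ((continuous_const.mul h1).add (continuous_const.mul h2)).continuousOn

theorem continuousOn_g {ρ : ℝ} (hρ : -1 < ρ) : ContinuousOn (g ρ) (Icc 0 1) :=
  (continuousOn_mean_rpow (one_div_pos.2 (by linarith))).rpow_const
    fun _ hz => Or.inl (mean_rpow_pos hz).ne'

theorem continuousOn_Dg {ρ : ℝ} (hρ : -1 < ρ) : ContinuousOn (Dg ρ) (Icc 0 1) := by
  have hs : 0 < 1 / (1 + ρ) := one_div_pos.2 (by linarith)
  have hA := continuousOn_mean_rpow hs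
  have hpos : ∀ z ∈ Icc (0 : ℝ) 1, (1 / 2) * (1 + z) ^ (1 / (1 + ρ)) +
      (1 / 2) * (1 - z) ^ (1 / (1 + ρ)) ≠ 0 := fun z hz => (mean_rpow_pos hz).ne'
  have hL := continuousOn_rpow_mul_log hs
  have h1 : ContinuousOn (fun z : ℝ => (1 + z) ^ (1 / (1 + ρ)) * log (1 + z)) (Icc 0 1) :=
    hL.comp (f := fun z : ℝ => 1 + z) (by fun_prop) fun z hz => by
      simp only [mem_Ici]; linarith [hz.1]
  have h2 : ContinuousOn (fun z : ℝ => (1 - z) ^ (1 / (1 + ρ)) * log (1 - z)) (Icc 0 1) :=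
    hL.comp (f := fun z : ℝ => 1 - z) (by fun_prop) fun z hz => by
      simp only [mem_Ici]; linarith [hz.2]
  have hB := ((h1.neg.div_const ((1 + ρ) ^ 2)).const_mul (1 / 2)).add
    ((h2.neg.div_const ((1 + ρ) ^ 2)).const_mul (1 / 2))
  have hC := ((hB.mul_const (1 + ρ)).mul (hA.rpow_const (p := 1 + ρ - 1)
    fun z hz => Or.inl (hpos z hz))).add
    (((hA.rpow_const (p := 1 + ρ) fun z hz => Or.inl (hpos z hz)).const_mul 1).mul
      (hA.log hpos))
  refine hC.congr fun z hz => ?_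
  have d1 := hasDerivAt_rpow_one_div (a := 1 + z) (by linarith [hz.1]) hρ
  have d2 := hasDerivAt_rpow_one_div (a := 1 - z) (by linarith [hz.2]) hρ
  have h1 : HasDerivAt (fun r : ℝ => 1 + r) 1 ρ := by
    simpa using (hasDerivAt_id ρ).const_add 1
  exact (((d1.const_mul (1 / 2)).add (d2.const_mul (1 / 2))).rpow h1 (mean_rpow_pos hz)).deriv

theorem hasDerivAt_g {ρ z : ℝ} (hρ : 0 < ρ) (hz : z ∈ Ioo (0 : ℝ) 1) :
    HasDerivAt (g ρ) (-exp (logSlope (1 / (1 + ρ)) (artanh z) - 2 * log (cosh (artanh z))) *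
      (1 / (1 - z ^ 2))) z := by
  have hz' : z ∈ Ioo (-1 : ℝ) 1 := ⟨by linarith [hz.1], hz.2⟩
  have hev : g ρ =ᶠ[𝓝 z] fun x => exp (1 / (1 / (1 + ρ)) * log (cosh (1 / (1 + ρ) * artanh x)) -
      log (cosh (artanh x))) := by
    filter_upwards [Ioo_mem_nhds hz'.1 hz'.2] with x hx
    conv_lhs => rw [← tanh_artanh hx, g_tanh (by linarith)]
    rw [one_div_one_div, one_div_mul_eq_div]
  have h := (hasDerivAt_exp_log_cosh (s := 1 / (1 + ρ)) (by positivity)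
    ((div_lt_one (by linarith)).2 (by linarith)) (artanh_pos hz)).comp z (hasDerivAt_artanh hz')
  exact h.congr_of_eventuallyEq hev

theorem hasDerivAt_Dg {ρ z : ℝ} (hρ : 0 < ρ) (hz : z ∈ Ioo (0 : ℝ) 1) :
    HasDerivAt (Dg ρ) (logSlopeRate (1 / (1 + ρ)) (artanh z) *
      -exp (logSlope (1 / (1 + ρ)) (artanh z) - 2 * log (cosh (artanh z))) *
      (1 / (1 - z ^ 2))) z := by
  have hz' : z ∈ Ioo (-1 : ℝ) 1 := ⟨by linarith [hz.1], hz.2⟩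
  have hev : Dg ρ =ᶠ[𝓝 z] fun x => exp (1 / (1 / (1 + ρ)) * log (cosh (1 / (1 + ρ) * artanh x)) -
      log (cosh (artanh x))) * (log (cosh (1 / (1 + ρ) * artanh x)) - 1 / (1 + ρ) * artanh x *
        (sinh (1 / (1 + ρ) * artanh x) / cosh (1 / (1 + ρ) * artanh x))) := by
    filter_upwards [Ioo_mem_nhds hz'.1 hz'.2] with x hx
    conv_lhs => rw [← tanh_artanh hx, Dg_tanh (by linarith)]
    rw [one_div_one_div, one_div_mul_eq_div]
  have h := (hasDerivAt_exp_log_cosh_mul (s := 1 / (1 + ρ)) (by positivity)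
    ((div_lt_one (by linarith)).2 (by linarith)) (artanh_pos hz)).comp z (hasDerivAt_artanh hz')
  exact h.congr_of_eventuallyEq hev

/-- Lemma 5, two-parameter case: for `0 < ρ₁ ≤ ρ₂ ≤ 1`, the map
`t ↦ D(ρ₂, g(ρ₁,·)⁻¹(t))` is concave, expressed through triples
`z, z₁, z₂ ∈ [0,1]` with `g(ρ₁, z) = λ·g(ρ₁, z₁) + (1−λ)·g(ρ₁, z₂)`. -/
theorem ftilde_concavity_two_param (ρ₁ ρ₂ : ℝ) (h1 : 0 < ρ₁) (h2 : ρ₁ ≤ ρ₂) (h3 : ρ₂ ≤ 1)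
    (z z₁ z₂ l : ℝ) (hz : z ∈ Set.Icc (0:ℝ) 1) (hz₁ : z₁ ∈ Set.Icc (0:ℝ) 1)
    (hz₂ : z₂ ∈ Set.Icc (0:ℝ) 1) (hl : l ∈ Set.Icc (0:ℝ) 1)
    (hg : g ρ₁ z = l * g ρ₁ z₁ + (1-l) * g ρ₁ z₂) :
    l * Dg ρ₂ z₁ + (1-l) * Dg ρ₂ z₂ ≤ Dg ρ₂ z := by
  have hs2 : 1 / 2 ≤ 1 / (1 + ρ₂) := one_div_le_one_div_of_le (by linarith) (by linarith)
  have hs21 : 1 / (1 + ρ₂) ≤ 1 / (1 + ρ₁) := one_div_le_one_div_of_le (by linarith) (by linarith)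
  have hs1 : 1 / (1 + ρ₁) < 1 := (div_lt_one (by linarith)).2 (by linarith)
  refine concave_of_derivative_ratio_mono (k := g ρ₁)
    (r := fun x => logSlopeRate (1 / (1 + ρ₂)) (artanh x) *
      exp (logSlope (1 / (1 + ρ₂)) (artanh x) - logSlope (1 / (1 + ρ₁)) (artanh x)))
    (continuousOn_Dg (by linarith)) (continuousOn_g (by linarith))
    (fun x hx => hasDerivAt_Dg (by linarith) hx) (fun x hx => hasDerivAt_g h1 hx)
    ?_ ?_ ?_ hz hz₁ hz₂ hl hg
  · intro x hx
    have : 0 < 1 - x ^ 2 := by nlinarith [hx.1, hx.2]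
    exact mul_neg_of_neg_of_pos (neg_neg_of_pos (exp_pos _)) (by positivity)
  · intro x _
    have e : logSlope (1 / (1 + ρ₂)) (artanh x) - 2 * log (cosh (artanh x)) =
        (logSlope (1 / (1 + ρ₂)) (artanh x) - logSlope (1 / (1 + ρ₁)) (artanh x)) +
        (logSlope (1 / (1 + ρ₁)) (artanh x) - 2 * log (cosh (artanh x))) := by ring
    rw [e, exp_add]
    ring
  · intro x hx y hy hxy
    have hu := artanh_pos hx
    have hw := artanh_pos hy
    have huw : artanh x ≤ artanh y := artanh_le_artanh (by linarith [hx.1]) hy.2 hxy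
    exact mul_le_mul (logSlopeRate_mono hs2 (by linarith) hu hw huw)
      (exp_le_exp.2 (logSlope_sub_mono hs2 hs21 hs1 hu hw huw)) (exp_pos _).le
      (logSlopeRate_nonneg hs2 (by linarith) hw)
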